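/- arXiv:1110.1882 — 2 statements merged into one kernel-verified Lean document; each statement's English description precedes it below -/
import Mathlib

section
/- The simple vertex operator algebra L(1,0,0) (the unique irreducible quotient of the W_3 vacuum module M̄(1,0,0) at central charge c = 1) is not completely reducible as a module over the Virasoro algebra, i.e., as a module over its vertex operator subalgebra L(1,0) generated by the conformal vector ω = L_{−2}1. -/
open scoped BigOperators

/-- A representation of the `𝒲₃` algebra at central charge `c` with a
vacuum-like vector `one` annihilated by all nonnegative modes together with
`L₋₁`, `W₋₁` and `W₋₂`.  The term `Λ` in the `[W,W]` relation is written as a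
truncated (eventually constant) sum, which is meaningful thanks to the lower
truncation axiom. -/
structure W3Rep (c : ℂ) where
  carrier : Type
  [addCommGroupCarrier : AddCommGroup carrier]
  [moduleCarrier : Module ℂ carrier]
  L : ℤ → carrier →ₗ[ℂ] carrier
  W : ℤ → carrier →ₗ[ℂ] carrier
  one : carrier
  L_one : ∀ n : ℤ, -1 ≤ n → L n one = 0
  W_one : ∀ n : ℤ, -2 ≤ n → W n one = 0
  truncation : ∀ v : carrier, ∃ N : ℤ, ∀ n : ℤ, N ≤ n → L n v = 0 ∧ W n v = 0
  relLL : ∀ (m n : ℤ) (v : carrier),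
    L m (L n v) - L n (L m v)
      = ((m - n : ℤ) : ℂ) • L (m + n) v
        + (if m + n = 0 then ((m ^ 3 - m : ℤ) : ℂ) / 12 * c else 0) • v
  relLW : ∀ (m n : ℤ) (v : carrier),
    L m (W n v) - W n (L m v) = ((2 * m - n : ℤ) : ℂ) • W (m + n) v
  relWW : ∀ (m n : ℤ) (v : carrier), ∃ N : ℕ, ∀ K : ℕ, N ≤ K →
    W m (W n v) - W n (W m v)
      = (((m - n : ℤ) : ℂ) *
            ((1 / 15 : ℂ) * (((m + n + 2) * (m + n + 3) : ℤ) : ℂ)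
              - (1 / 6 : ℂ) * (((m + 2) * (n + 2) : ℤ) : ℂ))) • L (m + n) v
        + ((16 / (22 + 5 * c)) * ((m - n : ℤ) : ℂ)) •
            ((∑ j ∈ Finset.range K, L (-((j : ℤ) + 2)) (L (m + n + ((j : ℤ) + 2)) v))
              + (∑ j ∈ Finset.range K, L (m + n - ((j : ℤ) - 1)) (L ((j : ℤ) - 1) v))
              - ((3 / 10 : ℂ) * (((m + n + 2) * (m + n + 3) : ℤ) : ℂ)) • L (m + n) v)
        + (if m + n = 0 then ((m * (m ^ 2 - 1) * (m ^ 2 - 4) : ℤ) : ℂ) / 360 * c else 0) • v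

attribute [instance] W3Rep.addCommGroupCarrier W3Rep.moduleCarrier

namespace W3Rep

variable {c : ℂ} (M : W3Rep c)

/-- The generator `w = W₋₃𝟙`. -/
def w : M.carrier := M.W (-3) M.one

/-- A subspace stable under all the operators `L n` and `W n`. -/
def Invariant (N : Submodule ℂ M.carrier) : Prop :=
  ∀ n : ℤ, ∀ x ∈ N, M.L n x ∈ N ∧ M.W n x ∈ N

/-- A subspace stable under all the Virasoro operators `L n`. -/
def VirInvariant (N : Submodule ℂ M.carrier) : Prop :=
  ∀ n : ℤ, ∀ x ∈ N, M.L n x ∈ N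

/-- The module for the Virasoro algebra generated by a vector. -/
def VirGen (v : M.carrier) : Submodule ℂ M.carrier :=
  sInf {N : Submodule ℂ M.carrier | v ∈ N ∧ M.VirInvariant N}

lemma mem_VirGen_self (v : M.carrier) : v ∈ M.VirGen v :=
  Submodule.mem_sInf.2 fun _ hN => hN.1

/-- The weight-`r` subspace: the `L₀`-eigenspace with eigenvalue `r`. -/
def wt (r : ℂ) : Submodule ℂ M.carrier :=
  LinearMap.ker (M.L 0 - r • (LinearMap.id : M.carrier →ₗ[ℂ] M.carrier))

/-- A primary vector: a nonzero vector killed by all `L n`, `n ≥ 1`. -/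
def IsPrimary (v : M.carrier) : Prop :=
  v ≠ 0 ∧ ∀ n : ℤ, 1 ≤ n → M.L n v = 0

/-- Irreducibility of a `𝒲₃`-representation. -/
def Irreducible : Prop :=
  (⊥ : Submodule ℂ M.carrier) ≠ ⊤ ∧
    ∀ N : Submodule ℂ M.carrier, M.Invariant N → N = ⊥ ∨ N = ⊤

end W3Rep

/-- A homomorphism of `𝒲₃`-representations sending vacuum to vacuum. -/
structure W3Hom {c : ℂ} (M N : W3Rep c) where
  f : M.carrier →ₗ[ℂ] N.carrier
  map_one : f M.one = N.one
  map_L : ∀ (n : ℤ) (v : M.carrier), f (M.L n v) = N.L n (f v)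
  map_W : ∀ (n : ℤ) (v : M.carrier), f (M.W n v) = N.W n (f v)

/-- The `𝒲₃` vacuum vertex operator algebra `M̄(c,0,0)`: the universal
`𝒲₃`-representation generated by a vacuum vector annihilated by all
nonnegative modes together with `L₋₁`, `W₋₁`, `W₋₂`. -/
structure W3Vacuum (c : ℂ) extends W3Rep c where
  one_ne : one ≠ 0
  universal : ∀ M : W3Rep c, ∃ φ : W3Hom toW3Rep M, ∀ ψ : W3Hom toW3Rep M, ψ = φ

namespace W3Rep

variable {c : ℂ} (Q : W3Rep c)

lemma L_L_swap {m n : ℤ} (_ : n < m) (v : Q.carrier) :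
    Q.L m (Q.L n v) = Q.L n (Q.L m v) + ((m - n : ℤ) : ℂ) • Q.L (m + n) v
      + (if m + n = 0 then ((m ^ 3 - m : ℤ) : ℂ) / 12 * c else 0) • v := by
  rw [add_assoc, ← Q.relLL m n v]; abel

lemma L_W (m n : ℤ) (v : Q.carrier) :
    Q.L m (Q.W n v) = Q.W n (Q.L m v) + ((2 * m - n : ℤ) : ℂ) • Q.W (m + n) v := by
  rw [← Q.relLW m n v]; abel

lemma L_W_swap {m : ℤ} (_ : -1 ≤ m) (n : ℤ) (v : Q.carrier) :
    Q.L m (Q.W n v) = Q.W n (Q.L m v) + ((2 * m - n : ℤ) : ℂ) • Q.W (m + n) v :=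
  Q.L_W m n v

lemma W_L (m n : ℤ) (v : Q.carrier) :
    Q.W m (Q.L n v) = Q.L n (Q.W m v) - ((2 * n - m : ℤ) : ℂ) • Q.W (m + n) v := by
  rw [L_W, add_comm n m]; abel

lemma W_L_swap {n : ℤ} (_ : n ≤ -2) (m : ℤ) (v : Q.carrier) :
    Q.W m (Q.L n v) = Q.L n (Q.W m v) - ((2 * n - m : ℤ) : ℂ) • Q.W (m + n) v :=
  Q.W_L m n v

/-- The truncation of `Λ_p v` to finitely many terms. -/
noncomputable def lam (p : ℤ) (K₁ K₂ : ℕ) (v : Q.carrier) : Q.carrier :=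
  (∑ j ∈ Finset.range K₁, Q.L (-((j : ℤ) + 2)) (Q.L (p + ((j : ℤ) + 2)) v))
    + (∑ j ∈ Finset.range K₂, Q.L (p - ((j : ℤ) - 1)) (Q.L ((j : ℤ) - 1) v))
    - ((3 / 10 : ℂ) * (((p + 2) * (p + 3) : ℤ) : ℂ)) • Q.L p v

lemma W_W_of_bounds (m n : ℤ) (K₁ K₂ : ℕ) (v : Q.carrier)
    (h₁ : ∀ j : ℤ, m + n + K₁ + 2 ≤ j → Q.L j v = 0)
    (h₂ : ∀ j : ℤ, (K₂ : ℤ) - 1 ≤ j → Q.L j v = 0) :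
    Q.W m (Q.W n v) = Q.W n (Q.W m v) + ((((m - n : ℤ) : ℂ) *
            ((1 / 15 : ℂ) * (((m + n + 2) * (m + n + 3) : ℤ) : ℂ)
              - (1 / 6 : ℂ) * (((m + 2) * (n + 2) : ℤ) : ℂ))) • Q.L (m + n) v
        + ((16 / (22 + 5 * c)) * ((m - n : ℤ) : ℂ)) • Q.lam (m + n) K₁ K₂ v
        + (if m + n = 0 then ((m * (m ^ 2 - 1) * (m ^ 2 - 4) : ℤ) : ℂ) / 360 * c else 0) • v) := by
  obtain ⟨N, hN⟩ := Q.relWW m n v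
  have key := hN (N + K₁ + K₂) (by omega)
  have e₁ : ∑ j ∈ Finset.range (N + K₁ + K₂),
      Q.L (-((j : ℤ) + 2)) (Q.L (m + n + ((j : ℤ) + 2)) v)
      = ∑ j ∈ Finset.range K₁, Q.L (-((j : ℤ) + 2)) (Q.L (m + n + ((j : ℤ) + 2)) v) := by
    symm
    refine Finset.sum_subset (Finset.range_mono (by omega)) fun j _ hj => ?_
    rw [h₁ _ (by simp at hj; omega), map_zero]
  have e₂ : ∑ j ∈ Finset.range (N + K₁ + K₂),
      Q.L (m + n - ((j : ℤ) - 1)) (Q.L ((j : ℤ) - 1) v)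
      = ∑ j ∈ Finset.range K₂, Q.L (m + n - ((j : ℤ) - 1)) (Q.L ((j : ℤ) - 1) v) := by
    symm
    refine Finset.sum_subset (Finset.range_mono (by omega)) fun j _ hj => ?_
    rw [h₂ _ (by simp at hj; omega), map_zero]
  rw [e₁, e₂] at key
  rw [lam, ← key]; abel

lemma L_W_one {j k : ℤ} (hj : -1 ≤ j) (hk : -2 ≤ j + k) : Q.L j (Q.W k Q.one) = 0 := by
  rw [L_W, Q.L_one j hj, Q.W_one _ hk]; simp

lemma W_W_one_swap {m n : ℤ} (_ : n < m) :
    Q.W m (Q.W n Q.one) = Q.W n (Q.W m Q.one) + ((((m - n : ℤ) : ℂ) *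
            ((1 / 15 : ℂ) * (((m + n + 2) * (m + n + 3) : ℤ) : ℂ)
              - (1 / 6 : ℂ) * (((m + 2) * (n + 2) : ℤ) : ℂ))) • Q.L (m + n) Q.one
        + ((16 / (22 + 5 * c)) * ((m - n : ℤ) : ℂ)) • Q.lam (m + n) (-3 - m - n).toNat 0 Q.one
        + (if m + n = 0 then ((m * (m ^ 2 - 1) * (m ^ 2 - 4) : ℤ) : ℂ) / 360 * c else 0)
          • Q.one) :=
  Q.W_W_of_bounds m n _ _ _ (fun j hj => Q.L_one j (by omega)) fun j hj => Q.L_one j (by omega)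

lemma W_W_W_one_swap {m n : ℤ} (k : ℤ) (_ : n < m) :
    Q.W m (Q.W n (Q.W k Q.one)) = Q.W n (Q.W m (Q.W k Q.one)) + ((((m - n : ℤ) : ℂ) *
            ((1 / 15 : ℂ) * (((m + n + 2) * (m + n + 3) : ℤ) : ℂ)
              - (1 / 6 : ℂ) * (((m + 2) * (n + 2) : ℤ) : ℂ))) • Q.L (m + n) (Q.W k Q.one)
        + ((16 / (22 + 5 * c)) * ((m - n : ℤ) : ℂ)) •
          Q.lam (m + n) ((-3 - m - n).toNat + (-4 - k - m - n).toNat) (-1 - k).toNat (Q.W k Q.one)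
        + (if m + n = 0 then ((m * (m ^ 2 - 1) * (m ^ 2 - 4) : ℤ) : ℂ) / 360 * c else 0)
          • Q.W k Q.one) :=
  Q.W_W_of_bounds m n _ _ _ (fun j hj => Q.L_W_one (by omega) (by omega))
    fun j hj => Q.L_W_one (by omega) (by omega)

lemma W_W_one_eq_zero {m n : ℤ} (hm : -2 ≤ m) (hmn : 1 ≤ m + n) :
    Q.W m (Q.W n Q.one) = 0 := by
  have h := Q.W_W_of_bounds m n 0 0 Q.one (fun j hj => Q.L_one j (by simp at hj; omega))
    fun j hj => Q.L_one j (by simpa using hj)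
  rw [h, Q.W_one m hm, Q.L_one _ (by omega), lam, Q.L_one _ (by omega), if_neg (by omega)]
  simp

lemma L_W_W_one_eq_zero {j : ℤ} (hj : 7 ≤ j) :
    Q.L j (Q.W (-3) (Q.W (-3) Q.one)) = 0 := by
  rw [L_W, L_W_one _ (by omega) (by omega), W_W_one_eq_zero _ (by omega) (by omega)]; simp

lemma W_W_W_W_one_swap {m : ℤ} (_ : -3 < m) :
    Q.W m (Q.W (-3) (Q.W (-3) (Q.W (-3) Q.one)))
      = Q.W (-3) (Q.W m (Q.W (-3) (Q.W (-3) Q.one))) + ((((m - -3 : ℤ) : ℂ) *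
            ((1 / 15 : ℂ) * (((m + -3 + 2) * (m + -3 + 3) : ℤ) : ℂ)
              - (1 / 6 : ℂ) * (((m + 2) * (-3 + 2) : ℤ) : ℂ)))
            • Q.L (m + -3) (Q.W (-3) (Q.W (-3) Q.one))
        + ((16 / (22 + 5 * c)) * ((m - -3 : ℤ) : ℂ)) •
          Q.lam (m + -3) (8 - m).toNat 8 (Q.W (-3) (Q.W (-3) Q.one))
        + (if m + -3 = 0 then ((m * (m ^ 2 - 1) * (m ^ 2 - 4) : ℤ) : ℂ) / 360 * c else 0)
          • Q.W (-3) (Q.W (-3) Q.one)) :=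
  Q.W_W_of_bounds m (-3) _ _ _ (fun j hj => Q.L_W_W_one_eq_zero (by omega))
    fun j hj => Q.L_W_W_one_eq_zero (by push_cast at hj; omega)

end W3Rep

namespace W3Rep

variable (Q : W3Rep 1)

/-- The recursion `m (7 - m) vₘ = ∑ₖ (-1) ^ (k - 1) L₋ₖ vₘ₋ₖ`, `m ≤ 6`, whose continuation to `m = 7`
is the level 7 singular vector of the Verma module of highest weight 9 at central charge 1. -/
noncomputable def chain : ℕ → Q.carrier →ₗ[ℂ] Q.carrier
  | 0 => LinearMap.id
  | m + 1 => (1 / ((m + 1) * (6 - m)) : ℂ) •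
      ∑ k : Fin (m + 1), ((-1 : ℂ) ^ (k : ℕ)) • Q.L (-((k : ℤ) + 1)) ∘ₗ chain (m - k)

/-- The level 7 singular vector of the Verma module of highest weight 9 at central charge 1. -/
noncomputable def singular : Q.carrier →ₗ[ℂ] Q.carrier :=
  ∑ k : Fin 7, ((-1 : ℂ) ^ (k : ℕ)) • Q.L (-((k : ℤ) + 1)) ∘ₗ Q.chain (6 - k)

lemma chain_succ (m : ℕ) : Q.chain (m + 1) = (1 / ((m + 1) * (6 - m)) : ℂ) •
    ∑ k : Fin (m + 1), ((-1 : ℂ) ^ (k : ℕ)) • Q.L (-((k : ℤ) + 1)) ∘ₗ Q.chain (m - k) := by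
  rw [chain]

lemma chain_zero (u : Q.carrier) : Q.chain 0 u = u := by simp [chain]

lemma chain_one (u : Q.carrier) : Q.chain 1 u = (1 / 6 : ℂ) • Q.L (-1) (Q.chain 0 u) :=
  (LinearMap.congr_fun (Q.chain_succ 0) u).trans <| by simp

lemma chain_two (u : Q.carrier) : Q.chain 2 u = (1 / 10 : ℂ) •
    (Q.L (-1) (Q.chain 1 u) - Q.L (-2) (Q.chain 0 u)) :=
  (LinearMap.congr_fun (Q.chain_succ 1) u).trans <| by
    norm_num [Fin.sum_univ_succ]
    module

lemma chain_three (u : Q.carrier) : Q.chain 3 u = (1 / 12 : ℂ) •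
    (Q.L (-1) (Q.chain 2 u) - Q.L (-2) (Q.chain 1 u) + Q.L (-3) (Q.chain 0 u)) :=
  (LinearMap.congr_fun (Q.chain_succ 2) u).trans <| by
    norm_num [Fin.sum_univ_succ]
    module

lemma chain_four (u : Q.carrier) : Q.chain 4 u = (1 / 12 : ℂ) •
    (Q.L (-1) (Q.chain 3 u) - Q.L (-2) (Q.chain 2 u) + Q.L (-3) (Q.chain 1 u)
      - Q.L (-4) (Q.chain 0 u)) :=
  (LinearMap.congr_fun (Q.chain_succ 3) u).trans <| by
    norm_num [Fin.sum_univ_succ]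
    module

lemma chain_five (u : Q.carrier) : Q.chain 5 u = (1 / 10 : ℂ) •
    (Q.L (-1) (Q.chain 4 u) - Q.L (-2) (Q.chain 3 u) + Q.L (-3) (Q.chain 2 u)
      - Q.L (-4) (Q.chain 1 u) + Q.L (-5) (Q.chain 0 u)) :=
  (LinearMap.congr_fun (Q.chain_succ 4) u).trans <| by
    norm_num [Fin.sum_univ_succ]
    module

lemma chain_six (u : Q.carrier) : Q.chain 6 u = (1 / 6 : ℂ) •
    (Q.L (-1) (Q.chain 5 u) - Q.L (-2) (Q.chain 4 u) + Q.L (-3) (Q.chain 3 u)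
      - Q.L (-4) (Q.chain 2 u) + Q.L (-5) (Q.chain 1 u) - Q.L (-6) (Q.chain 0 u)) :=
  (LinearMap.congr_fun (Q.chain_succ 5) u).trans <| by
    norm_num [Fin.sum_univ_succ]
    module
lemma singular_apply (u : Q.carrier) : Q.singular u =
    Q.L (-1) (Q.chain 6 u) - Q.L (-2) (Q.chain 5 u) + Q.L (-3) (Q.chain 4 u)
      - Q.L (-4) (Q.chain 3 u) + Q.L (-5) (Q.chain 2 u) - Q.L (-6) (Q.chain 1 u)
      + Q.L (-7) (Q.chain 0 u) := by
  rw [singular]; norm_num [Fin.sum_univ_succ]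
  module

/-- A Virasoro primary vector of weight 9, or zero. -/
structure PrimaryNine (u : Q.carrier) : Prop where
  zero : Q.L 0 u = (9 : ℂ) • u
  one : Q.L 1 u = 0
  two : Q.L 2 u = 0

lemma L_eq_zero_of_L_one_two {u : Q.carrier} (h₁ : Q.L 1 u = 0) (h₂ : Q.L 2 u = 0) (k : ℕ) :
    Q.L (k + 1) u = 0 := by
  induction k with
  | zero => simpa using h₁
  | succ k ih =>
    rcases k with _ | k
    · simpa using h₂
    · have h := Q.relLL (((k + 1 : ℕ) : ℤ) + 1) 1 u
      rw [h₁, ih, if_neg (by omega)] at h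
      have h' : (((((k + 1 : ℕ) : ℤ) + 1 - 1 : ℤ)) : ℂ) ≠ 0 := by
        rw [Int.cast_ne_zero]; omega
      simp only [map_zero, sub_zero, zero_smul, add_zero] at h
      have := (smul_eq_zero.1 h.symm).resolve_left h'
      push_cast at this ⊢
      convert this using 2

lemma L_zero_L {r : ℂ} {u : Q.carrier} (h : Q.L 0 u = r • u) (k : ℤ) :
    Q.L 0 (Q.L k u) = (r - k) • Q.L k u := by
  have := Q.relLL 0 k u
  rw [h, map_smul] at this
  have h0 : (if (0 : ℤ) + k = 0 then (((0 : ℤ) ^ 3 - 0 : ℤ) : ℂ) / 12 * (1 : ℂ) else 0) = 0 := by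
    split_ifs <;> simp
  rw [h0, zero_smul, add_zero, zero_add, sub_eq_iff_eq_add] at this
  rw [this]; push_cast; module

lemma L_zero_chain {u : Q.carrier} (h : Q.L 0 u = (9 : ℂ) • u) (m : ℕ) :
    Q.L 0 (Q.chain m u) = (9 + m : ℂ) • Q.chain m u := by
  induction m using Nat.strong_induction_on with
  | _ m ih =>
    rcases m with _ | m
    · simpa [chain_zero] using h
    · simp only [chain_succ, LinearMap.smul_apply, LinearMap.sum_apply, LinearMap.comp_apply,
        map_smul, map_sum, Finset.smul_sum]
      refine Finset.sum_congr rfl fun k _ => ?_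
      rw [Q.L_zero_L (ih (m - k) (by omega))]
      have : ((m - k : ℕ) : ℂ) = m - (k : ℕ) := Nat.cast_sub (by omega)
      rw [this]; push_cast; module

variable {Q} in
lemma L_one_two_singular {u : Q.carrier} (hu : Q.PrimaryNine u) :
    Q.L 1 (Q.singular u) = 0 ∧ Q.L 2 (Q.singular u) = 0 := by
  have z0 := Q.L_zero_chain hu.zero 0
  have z1 := Q.L_zero_chain hu.zero 1
  have z2 := Q.L_zero_chain hu.zero 2
  have z3 := Q.L_zero_chain hu.zero 3
  have z4 := Q.L_zero_chain hu.zero 4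
  have z5 := Q.L_zero_chain hu.zero 5
  have z6 := Q.L_zero_chain hu.zero 6
  have a0 : Q.L 1 (Q.chain 0 u) = 0 := by rw [chain_zero, hu.one]
  have a1 : Q.L 1 (Q.chain 1 u) = (3 : ℂ) • Q.chain 0 u := by
    rw [chain_one]
    simp [L_L_swap, a0, z0]
    module
  have a2 : Q.L 1 (Q.chain 2 u) = (2 : ℂ) • Q.chain 1 u := by
    rw [chain_two]
    simp [L_L_swap, a0, a1, z1]
    rw [chain_one]
    module
  have a3 : Q.L 1 (Q.chain 3 u) = (1 : ℂ) • Q.chain 2 u := by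
    rw [chain_three]
    simp [L_L_swap, a0, a1, a2, z2]
    rw [chain_two]
    module
  have a4 : Q.L 1 (Q.chain 4 u) = (0 : ℂ) • Q.chain 3 u := by
    rw [chain_four]
    simp [L_L_swap, a0, a1, a2, a3, z3]
    rw [chain_three]
    module
  have a5 : Q.L 1 (Q.chain 5 u) = (-1 : ℂ) • Q.chain 4 u := by
    rw [chain_five]
    simp [L_L_swap, a0, a1, a2, a3, a4, z4]
    rw [chain_four]
    module
  have a6 : Q.L 1 (Q.chain 6 u) = (-2 : ℂ) • Q.chain 5 u := by
    rw [chain_six]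
    simp [L_L_swap, a0, a1, a2, a3, a4, a5, z5]
    rw [chain_five]
    module
  have b0 : Q.L 2 (Q.chain 0 u) = 0 := by rw [chain_zero, hu.two]
  have b1 : Q.L 2 (Q.chain 1 u) = 0 := by
    rw [chain_one]
    simp [L_L_swap, a0, b0]
  have b2 : Q.L 2 (Q.chain 2 u) = (-11 / 4 : ℂ) • Q.chain 0 u := by
    rw [chain_two]
    simp [L_L_swap, a1, b0, b1, z0]
    module
  have b3 : Q.L 2 (Q.chain 3 u) = (-7 / 4 : ℂ) • Q.chain 1 u := by
    rw [chain_three]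
    simp [L_L_swap, a2, b0, b1, b2, z1]
    rw [chain_one]
    module
  have b4 : Q.L 2 (Q.chain 4 u) = (-3 / 4 : ℂ) • Q.chain 2 u := by
    rw [chain_four]
    simp [L_L_swap, a3, b0, b1, b2, b3, z2]
    rw [chain_two]
    module
  have b5 : Q.L 2 (Q.chain 5 u) = (1 / 4 : ℂ) • Q.chain 3 u := by
    rw [chain_five]
    simp [L_L_swap, a4, b0, b1, b2, b3, b4, z3]
    rw [chain_three]
    module
  have b6 : Q.L 2 (Q.chain 6 u) = (5 / 4 : ℂ) • Q.chain 4 u := by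
    rw [chain_six]
    simp [L_L_swap, a5, b0, b1, b2, b3, b4, b5, z4]
    rw [chain_four]
    module
  constructor
  · rw [singular_apply]
    simp [L_L_swap, a0, a1, a2, a3, a4, a5, a6, z6]
    rw [chain_six]
    module
  · rw [singular_apply]
    simp [L_L_swap, a6, b0, b1, b2, b3, b4, b5, b6, z5]
    rw [chain_five]
    module

variable {Q} in
lemma L_zero_singular {u : Q.carrier} (hu : Q.PrimaryNine u) :
    Q.L 0 (Q.singular u) = (16 : ℂ) • Q.singular u := by
  simp only [singular, LinearMap.smul_apply, LinearMap.sum_apply, LinearMap.comp_apply,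
    map_smul, map_sum, Finset.smul_sum]
  refine Finset.sum_congr rfl fun k _ => ?_
  rw [Q.L_zero_L (Q.L_zero_chain hu.zero (6 - k))]
  have : ((6 - k : ℕ) : ℂ) = 6 - (k : ℕ) := by rw [Nat.cast_sub (by omega)]; simp
  rw [this]; push_cast; module

variable {Q} in
lemma W_eq_zero_of_singular {u : Q.carrier} (hs : Q.singular u = 0)
    {a : ℤ} (ha : a ≠ 6) (h : ∀ n : ℤ, a < n → Q.W n u = 0) : Q.W a u = 0 := by
  set y := Q.W a u with hy
  have t0 : ∀ n, a < n → Q.W n (Q.chain 0 u) = 0 := by simpa only [chain_zero] using h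
  have t1 : ∀ n, a + 1 < n → Q.W n (Q.chain 1 u) = 0 := fun n hn => by
    simp (disch := omega) [chain_one, W_L, t0]
  have t2 : ∀ n, a + 2 < n → Q.W n (Q.chain 2 u) = 0 := fun n hn => by
    simp (disch := omega) [chain_two, W_L, t0, t1]
  have t3 : ∀ n, a + 3 < n → Q.W n (Q.chain 3 u) = 0 := fun n hn => by
    simp (disch := omega) [chain_three, W_L, t0, t1, t2]
  have t4 : ∀ n, a + 4 < n → Q.W n (Q.chain 4 u) = 0 := fun n hn => by
    simp (disch := omega) [chain_four, W_L, t0, t1, t2, t3]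
  have t5 : ∀ n, a + 5 < n → Q.W n (Q.chain 5 u) = 0 := fun n hn => by
    simp (disch := omega) [chain_five, W_L, t0, t1, t2, t3, t4]
  have t6 : ∀ n, a + 6 < n → Q.W n (Q.chain 6 u) = 0 := fun n hn => by
    simp (disch := omega) [chain_six, W_L, t0, t1, t2, t3, t4, t5]
  have top : ∀ {x : Q.carrier} {z : ℂ} {m : ℤ}, Q.W (a + m) x = z • y →
      ∀ n, n = a + m → Q.W n x = z • y := by
    rintro x z m hx n rfl; exact hx
  obtain ⟨z0, s0, e0⟩ : ∃ z : ℂ, (∀ n, n = a + 0 → Q.W n (Q.chain 0 u) = z • y) ∧ z = 1 :=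
    ⟨_, top (by simp [chain_zero, hy]), rfl⟩
  obtain ⟨z1, s1, e1⟩ : ∃ z : ℂ, (∀ n, n = a + 1 → Q.W n (Q.chain 1 u) = z • y) ∧
      z = 1 / 6 * ((a + 3) * z0) := ⟨_, top (by
    simp (disch := omega) [chain_one, W_L, t0, s0]
    module), rfl⟩
  obtain ⟨z2, s2, e2⟩ : ∃ z : ℂ, (∀ n, n = a + 2 → Q.W n (Q.chain 2 u) = z • y) ∧
      z = 1 / 10 * ((a + 4) * z1 - (a + 6) * z0) := ⟨_, top (by
    simp (disch := omega) [chain_two, W_L, t0, t1, s0, s1]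
    module), rfl⟩
  obtain ⟨z3, s3, e3⟩ : ∃ z : ℂ, (∀ n, n = a + 3 → Q.W n (Q.chain 3 u) = z • y) ∧
      z = 1 / 12 * ((a + 5) * z2 - (a + 7) * z1 + (a + 9) * z0) := ⟨_, top (by
    simp (disch := omega) [chain_three, W_L, t0, t1, t2, s0, s1, s2]
    module), rfl⟩
  obtain ⟨z4, s4, e4⟩ : ∃ z : ℂ, (∀ n, n = a + 4 → Q.W n (Q.chain 4 u) = z • y) ∧
      z = 1 / 12 * ((a + 6) * z3 - (a + 8) * z2 + (a + 10) * z1 - (a + 12) * z0) := ⟨_, top (by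
    simp (disch := omega) [chain_four, W_L, t0, t1, t2, t3, s0, s1, s2, s3]
    module), rfl⟩
  obtain ⟨z5, s5, e5⟩ : ∃ z : ℂ, (∀ n, n = a + 5 → Q.W n (Q.chain 5 u) = z • y) ∧
      z = 1 / 10 * ((a + 7) * z4 - (a + 9) * z3 + (a + 11) * z2 - (a + 13) * z1
        + (a + 15) * z0) := ⟨_, top (by
    simp (disch := omega) [chain_five, W_L, t0, t1, t2, t3, t4, s0, s1, s2, s3, s4]
    module), rfl⟩
  obtain ⟨z6, s6, e6⟩ : ∃ z : ℂ, (∀ n, n = a + 6 → Q.W n (Q.chain 6 u) = z • y) ∧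
      z = 1 / 6 * ((a + 8) * z5 - (a + 10) * z4 + (a + 12) * z3 - (a + 14) * z2
        + (a + 16) * z1 - (a + 18) * z0) := ⟨_, top (by
    simp (disch := omega) [chain_six, W_L, t0, t1, t2, t3, t4, t5, s0, s1, s2, s3, s4, s5]
    module), rfl⟩
  have key : ((a + 9) * z6 - (a + 11) * z5 + (a + 13) * z4 - (a + 15) * z3
        + (a + 17) * z2 - (a + 19) * z1 + (a + 21) * z0) • y = 0 := by
    have h0 : Q.W (a + 7) (Q.singular u) = 0 := by rw [hs, map_zero]
    rw [← h0, singular_apply]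
    simp (disch := omega) [W_L, t0, t1, t2, t3, t4, t5, t6, s0, s1, s2, s3, s4, s5, s6]
    module
  have poly : ((a + 9) * z6 - (a + 11) * z5 + (a + 13) * z4 - (a + 15) * z3
        + (a + 17) * z2 - (a + 19) * z1 + (a + 21) * z0 : ℂ)
      = (((a - 6) * ((6 - a - 1) ^ 2 - 12) * ((6 - a - 4) ^ 2 - 48) * ((6 - a - 9) ^ 2 - 108) : ℤ) : ℂ)
          / 518400 := by
    rw [e6, e5, e4, e3, e2, e1, e0]
    push_cast
    ring
  rw [poly] at key
  refine (smul_eq_zero.1 key).resolve_left (div_ne_zero (Int.cast_ne_zero.2 ?_) (by norm_num))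
  have not_sq : ∀ b d : ℤ, ¬ IsSquare d → b ^ 2 - d ≠ 0 := fun b d hd hb =>
    hd ⟨b, by linarith⟩
  have h₁ := not_sq (6 - a - 1) 12 (by norm_num)
  have h₂ := not_sq (6 - a - 4) 48 (by norm_num)
  have h₃ := not_sq (6 - a - 9) 108 (by norm_num)
  exact mul_ne_zero (mul_ne_zero (mul_ne_zero (sub_ne_zero.2 ha) h₁) h₂) h₃

variable {Q} in
lemma W_eq_zero_of_singular_eq_zero {u : Q.carrier} (hs : Q.singular u = 0)
    (h6 : Q.W 6 u = 0) (n : ℤ) : Q.W n u = 0 := by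
  obtain ⟨N, hN⟩ := Q.truncation u
  have h : ∀ k : ℕ, ∀ n : ℤ, N - k ≤ n → Q.W n u = 0 := by
    intro k
    induction k with
    | zero => exact fun n hn => (hN n (by simpa using hn)).2
    | succ k ih =>
      intro n hn
      rcases eq_or_ne n 6 with rfl | hn6
      · exact h6
      · rcases le_or_gt (N - k) n with hle | hlt
        · exact ih n hle
        · exact W_eq_zero_of_singular hs hn6 fun p hp => ih p (by push_cast at hn; omega)
  exact h (N - n).toNat n (by omega)

/-- The smallest subspace containing `s` and stable under all `L n` with `n < 0`. -/
def lowering (s : Q.carrier) : Submodule ℂ Q.carrier :=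
  sInf {Z | s ∈ Z ∧ ∀ n < 0, ∀ x ∈ Z, Q.L n x ∈ Z}

lemma mem_lowering (s : Q.carrier) : s ∈ Q.lowering s :=
  Submodule.mem_sInf.2 fun _ hZ => hZ.1

lemma L_mem_lowering {s x : Q.carrier} {n : ℤ} (hn : n < 0) (hx : x ∈ Q.lowering s) :
    Q.L n x ∈ Q.lowering s :=
  Submodule.mem_sInf.2 fun Z hZ => hZ.2 n hn x (Submodule.mem_sInf.1 hx Z hZ)

lemma lowering_le {s : Q.carrier} {Z : Submodule ℂ Q.carrier} (hs : s ∈ Z)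
    (hZ : ∀ n < 0, ∀ x ∈ Z, Q.L n x ∈ Z) : Q.lowering s ≤ Z :=
  sInf_le ⟨hs, hZ⟩

lemma lowering_virInvariant {s : Q.carrier} {r : ℂ} (h₀ : Q.L 0 s = r • s)
    (h : ∀ k : ℕ, Q.L (k + 1) s = 0) : Q.VirInvariant (Q.lowering s) := by
  let Z : Submodule ℂ Q.carrier :=
    Q.lowering s ⊓ ⨅ n : ℕ, (Q.lowering s).comap (Q.L n)
  have hZ : Q.lowering s ≤ Z := by
    refine Q.lowering_le ⟨Q.mem_lowering s, ?_⟩ fun n hn x hx => ⟨Q.L_mem_lowering hn hx.1, ?_⟩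
    · refine Submodule.mem_iInf _ |>.2 fun k => ?_
      rw [Submodule.mem_comap]
      rcases k with _ | k
      · rw [Nat.cast_zero, h₀]
        exact Submodule.smul_mem _ _ (Q.mem_lowering s)
      · rw [Nat.cast_succ, h]
        exact zero_mem _
    · have hall : ∀ m : ℤ, Q.L m x ∈ Q.lowering s := fun m => by
        rcases lt_or_ge m 0 with hm | hm
        · exact Q.L_mem_lowering hm hx.1
        · lift m to ℕ using hm
          exact (Submodule.mem_iInf _).1 hx.2 m
      refine Submodule.mem_iInf _ |>.2 fun k => ?_
      rw [Submodule.mem_comap, Q.L_L_swap (by omega : n < (k : ℤ))]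
      exact add_mem (add_mem (Q.L_mem_lowering hn (hall k)) (Submodule.smul_mem _ _ (hall _)))
        (Submodule.smul_mem _ _ hx.1)
  intro n x hx
  rcases lt_or_ge n 0 with hn | hn
  · exact Q.L_mem_lowering hn hx
  · lift n to ℕ using hn
    exact (Submodule.mem_iInf _).1 (hZ hx).2 n

lemma lowering_le_iSup_eigenspace {s : Q.carrier} {r : ℂ} (h₀ : Q.L 0 s = r • s) :
    Q.lowering s ≤ ⨆ k : ℕ, Module.End.eigenspace (Q.L 0) (r + k) := by
  refine Q.lowering_le (Submodule.mem_iSup_of_mem 0 ?_) fun n hn x hx => ?_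
  · rw [Module.End.mem_eigenspace_iff, h₀]; simp
  · induction hx using Submodule.iSup_induction' with
    | mem k x hx =>
      refine Submodule.mem_iSup_of_mem (k + n.natAbs) ?_
      rw [Module.End.mem_eigenspace_iff] at hx ⊢
      rw [Q.L_zero_L hx]
      have : (n.natAbs : ℂ) = -(n : ℂ) := by
        rw [← Int.cast_neg, ← Int.cast_natCast]
        congr 1; omega
      rw [Nat.cast_add, this]; module
    | zero => rw [map_zero]; exact zero_mem _
    | add x y _ _ hx hy => rw [map_add]; exact add_mem hx hy

variable {Q} in
lemma singular_mem {N : Submodule ℂ Q.carrier} (hN : Q.VirInvariant N) {u : Q.carrier}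
    (hu : u ∈ N) : Q.singular u ∈ N := by
  have hc : ∀ m, Q.chain m u ∈ N := fun m => by
    induction m using Nat.strong_induction_on with
    | _ m ih =>
      rcases m with _ | m
      · rwa [chain_zero]
      · simp only [chain_succ, LinearMap.smul_apply, LinearMap.sum_apply, LinearMap.comp_apply]
        exact N.smul_mem _ <| N.sum_mem fun k _ => N.smul_mem _ <| hN _ _ (ih _ (by omega))
  simp only [singular, LinearMap.smul_apply, LinearMap.sum_apply, LinearMap.comp_apply]
  exact N.sum_mem fun k _ => N.smul_mem _ <| hN _ _ (hc _)

variable {Q} in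
lemma singular_eq_zero_of_simple {N : Submodule ℂ Q.carrier} (hN : Q.VirInvariant N)
    (hsimple : ∀ N' : Submodule ℂ Q.carrier, N' ≤ N → Q.VirInvariant N' → N' = ⊥ ∨ N' = N)
    {u : Q.carrier} (huN : u ∈ N) (hu : Q.PrimaryNine u) : Q.singular u = 0 := by
  set s := Q.singular u with hs
  have hL₀ := L_zero_singular hu
  have hsN : s ∈ N := singular_mem hN huN
  obtain ⟨h₁, h₂⟩ := L_one_two_singular hu
  rcases hsimple (Q.lowering s) (Q.lowering_le hsN fun n _ => hN n)
    (Q.lowering_virInvariant hL₀ (Q.L_eq_zero_of_L_one_two h₁ h₂)) with h | h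
  · simpa [h] using Q.mem_lowering s
  · have hu' : u ∈ ⨆ k : ℕ, Module.End.eigenspace (Q.L 0) (16 + k : ℂ) :=
      Q.lowering_le_iSup_eigenspace hL₀ (h ▸ huN)
    have hle : ⨆ k : ℕ, Module.End.eigenspace (Q.L 0) (16 + k : ℂ) ≤
        ⨆ (r : ℂ) (_ : r ≠ 9), Module.End.eigenspace (Q.L 0) r := by
      refine iSup_le fun k => le_iSup₂_of_le (16 + k : ℂ) ?_ le_rfl
      exact_mod_cast (by omega : 16 + k ≠ 9)
    have hu0 : u = 0 := (Submodule.disjoint_def.1 (Module.End.eigenspaces_iSupIndep (Q.L 0) 9)) u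
      (Module.End.mem_eigenspace_iff.2 hu.zero) (hle hu')
    rw [hs, hu0, map_zero]

variable {Q} in
lemma singular_eq_zero_of_decomposition {ι : Type} {N : ι → Submodule ℂ Q.carrier}
    (hN : ∀ i, Q.VirInvariant (N i) ∧ N i ≠ ⊥ ∧
      ∀ N' : Submodule ℂ Q.carrier, N' ≤ N i → Q.VirInvariant N' → N' = ⊥ ∨ N' = N i)
    (htop : (⨆ i, N i) = ⊤) (hind : iSupIndep N)
    {u : Q.carrier} (hu : Q.PrimaryNine u) : Q.singular u = 0 := by
  obtain ⟨f, hf, rfl⟩ := (Submodule.mem_iSup_iff_exists_finsupp N u).1 (htop ▸ Submodule.mem_top)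
  have hzero : ∀ T : Q.carrier →ₗ[ℂ] Q.carrier, (∀ i, ∀ x ∈ N i, T x ∈ N i) →
      T (f.sum fun _ x => x) = 0 → ∀ i, T (f i) = 0 := by
    intro T hT h i
    by_cases hi : i ∈ f.support
    · rw [Finsupp.sum, map_sum] at h
      exact (iSupIndep_iff_finsetSum_eq_zero_imp_eq_zero N).1 hind f.support (fun i => T (f i))
        (fun i _ => hT i _ (hf i)) h i hi
    · rw [Finsupp.notMem_support_iff.1 hi, map_zero]
  have hprim : ∀ i, Q.PrimaryNine (f i) := fun i =>
    { zero := sub_eq_zero.1 <| hzero (Q.L 0 - (9 : ℂ) • LinearMap.id)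
        (fun i x hx => sub_mem ((hN i).1 0 x hx) ((N i).smul_mem _ hx))
        (sub_eq_zero.2 hu.zero) i
      one := hzero _ (fun i => (hN i).1 1) hu.one i
      two := hzero _ (fun i => (hN i).1 2) hu.two i }
  rw [Finsupp.sum, map_sum]
  exact Finset.sum_eq_zero fun i _ =>
    singular_eq_zero_of_simple (hN i).1 (hN i).2.2 (hf i) (hprim i)

/-- The projection of `W₋₃³𝟙` to the primary vectors, along the Virasoro module generated by `w`. -/
noncomputable def primaryNine : Q.carrier :=
  Q.W (-3) (Q.W (-3) (Q.W (-3) Q.one))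
    + (3191560 / 552123 : ℂ) • Q.W (-9) Q.one
    + (42532 / 50193 : ℂ) • Q.L (-2) (Q.W (-7) Q.one)
    - (689477 / 184041 : ℂ) • Q.L (-3) (Q.W (-6) Q.one)
    + (894236 / 552123 : ℂ) • Q.L (-4) (Q.W (-5) Q.one)
    - (288296 / 184041 : ℂ) • Q.L (-2) (Q.L (-2) (Q.W (-5) Q.one))
    - (729910 / 552123 : ℂ) • Q.L (-5) (Q.W (-4) Q.one)
    + (451514 / 184041 : ℂ) • Q.L (-3) (Q.L (-2) (Q.W (-4) Q.one))
    - (11932 / 184041 : ℂ) • Q.L (-6) (Q.W (-3) Q.one)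
    - (190816 / 61347 : ℂ) • Q.L (-4) (Q.L (-2) (Q.W (-3) Q.one))
    - (832675 / 368082 : ℂ) • Q.L (-3) (Q.L (-3) (Q.W (-3) Q.one))
    + (70672 / 552123 : ℂ) • Q.L (-2) (Q.L (-2) (Q.L (-2) (Q.W (-3) Q.one)))

set_option maxHeartbeats 1000000
set_option linter.unusedSimpArgs false

lemma L_one_primaryNine : Q.L 1 Q.primaryNine = 0 := by
  simp [primaryNine, L_one, W_one, L_L_swap, L_W_swap, W_L_swap, W_W_one_swap, W_W_W_one_swap,
    W_W_W_W_one_swap, lam, Finset.sum_range_succ]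
  module

lemma L_two_primaryNine : Q.L 2 Q.primaryNine = 0 := by
  simp [primaryNine, L_one, W_one, L_L_swap, L_W_swap, W_L_swap, W_W_one_swap, W_W_W_one_swap,
    W_W_W_W_one_swap, lam, Finset.sum_range_succ]
  module

lemma L_zero_primaryNine : Q.L 0 Q.primaryNine = (9 : ℂ) • Q.primaryNine := by
  simp [primaryNine, L_one, W_one, L_L_swap, L_W_swap, W_L_swap, W_W_one_swap, W_W_W_one_swap,
    W_W_W_W_one_swap, lam, Finset.sum_range_succ]
  module

lemma W_six_primaryNine : Q.W 6 Q.primaryNine = 0 := by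
  simp [primaryNine, L_one, W_one, L_L_swap, L_W_swap, W_L_swap, W_W_one_swap, W_W_W_one_swap,
    W_W_W_W_one_swap, lam, Finset.sum_range_succ]
  module

lemma W_three_primaryNine : Q.W 3 Q.primaryNine =
    (3987125 / 184041 : ℂ) • Q.W (-3) (Q.W (-3) Q.one)
      + (637940 / 29403 : ℂ) • Q.L (-4) (Q.L (-2) Q.one)
      + (102708340 / 4969107 : ℂ) • Q.L (-6) Q.one
      - (181174960 / 14907321 : ℂ) • Q.L (-2) (Q.L (-2) (Q.L (-2) Q.one))
      - (52789535 / 3312738 : ℂ) • Q.L (-3) (Q.L (-3) Q.one) := by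
  simp [primaryNine, L_one, W_one, L_L_swap, L_W_swap, W_L_swap, W_W_one_swap, W_W_W_one_swap,
    W_W_W_W_one_swap, lam, Finset.sum_range_succ]
  module

lemma W_three_W_three_primaryNine : Q.W 3 (Q.W 3 Q.primaryNine) =
    (5103520 / 41067 : ℂ) • Q.W (-3) Q.one := by
  rw [W_three_primaryNine]
  simp [primaryNine, L_one, W_one, L_L_swap, L_W_swap, W_L_swap, W_W_one_swap, W_W_W_one_swap,
    W_W_W_W_one_swap, lam, Finset.sum_range_succ]
  module

lemma W_three_w : Q.W 3 (Q.W (-3) Q.one) = (1 / 3 : ℂ) • Q.one := by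
  simp [primaryNine, L_one, W_one, L_L_swap, L_W_swap, W_L_swap, W_W_one_swap, W_W_W_one_swap,
    W_W_W_W_one_swap, lam, Finset.sum_range_succ]
  module

lemma primaryNine_isPrimaryNine : Q.PrimaryNine Q.primaryNine :=
  ⟨Q.L_zero_primaryNine, Q.L_one_primaryNine, Q.L_two_primaryNine⟩

variable {Q} in
lemma singular_primaryNine_ne_zero (h1 : Q.one ≠ 0) : Q.singular Q.primaryNine ≠ 0 := by
  intro hs
  have h := W_eq_zero_of_singular_eq_zero hs Q.W_six_primaryNine 3
  have hw := Q.W_three_W_three_primaryNine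
  rw [h, map_zero, eq_comm] at hw
  have hw0 : Q.W (-3) Q.one = 0 := (smul_eq_zero.1 hw).resolve_left (by norm_num)
  have h3 := Q.W_three_w
  rw [hw0, map_zero, eq_comm] at h3
  exact h1 ((smul_eq_zero.1 h3).resolve_left (by norm_num))

end W3Rep

lemma W3Hom.one_ne_zero_of_surjective {c : ℂ} (M : W3Vacuum c) {Q : W3Rep c}
    (φ : W3Hom M.toW3Rep Q) (hsurj : Function.Surjective φ.f)
    (hQ : (⊥ : Submodule ℂ Q.carrier) ≠ ⊤) : Q.one ≠ 0 := by
  intro h1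
  obtain ⟨φ₀, h⟩ := M.universal Q
  let z : W3Hom M.toW3Rep Q :=
    { f := 0
      map_one := by simp [h1]
      map_L := by simp
      map_W := by simp }
  have hφ : φ.f = 0 := congrArg W3Hom.f ((h φ).trans (h z).symm)
  refine hQ (Submodule.ext fun x => ?_)
  obtain ⟨y, rfl⟩ := hsurj x
  simp [hφ]

/-- **Theorem 3.2.** The simple vertex operator algebra
`𝓛(1,0,0)` — the unique irreducible quotient of the `𝒲₃` vacuum module
`M̄(1,0,0)` at central charge `1` — is not completely reducible as a module
over the Virasoro algebra: it is not a direct sum of subspaces which are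
irreducible under all the `L n`. -/
theorem L100_not_Virasoro_completely_reducible
    (M : W3Vacuum 1) (Q : W3Rep 1) (φ : W3Hom M.toW3Rep Q)
    (hsurj : Function.Surjective φ.f) (hirr : Q.Irreducible) :
    ¬ ∃ (ι : Type) (N : ι → Submodule ℂ Q.carrier),
        (∀ i, Q.VirInvariant (N i) ∧ N i ≠ ⊥ ∧
          ∀ N' : Submodule ℂ Q.carrier, N' ≤ N i →
            Q.VirInvariant N' → N' = ⊥ ∨ N' = N i) ∧
        (⨆ i, N i) = ⊤ ∧
        (∀ i, N i ⊓ (⨆ (j) (_ : j ≠ i), N j) = ⊥) := by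
  rintro ⟨ι, N, hN, htop, hind⟩
  exact W3Rep.singular_primaryNine_ne_zero (φ.one_ne_zero_of_surjective M hsurj hirr.1) <|
    W3Rep.singular_eq_zero_of_decomposition hN htop (fun i => disjoint_iff.2 (hind i))
      Q.primaryNine_isPrimaryNine
end

section
/- In the W_3 vacuum vertex operator algebra M̄(1,0,0) at central charge c = 1, the homogeneous subspace of weight r has dimension r − 1 for 3 ≤ r ≤ 5; moreover M̄(1,0,0) contains no nonzero primary vector (i.e., vector annihilated by all L_n with n ≥ 1) of weight 4, of weight 5, or of weight 7. -/
open scoped BigOperators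

namespace W3Rep

variable {c : ℂ} (M : W3Rep c)

/-- Mode letters: `(false, n)` stands for `L n` and `(true, n)` for `W n`. -/
abbrev Letter := Bool × ℤ

/-- The operator named by a letter. -/
def op (a : Letter) : M.carrier →ₗ[ℂ] M.carrier := bif a.1 then M.W a.2 else M.L a.2

/-- The vector obtained by applying a word of modes to the vacuum. -/
def act (l : List Letter) : M.carrier := l.foldr (fun a v => M.op a v) M.one

/-- The conformal weight by which a word raises the `L₀`-eigenvalue. -/
def wordWt (l : List Letter) : ℤ := (l.map fun a => -a.2).sum

/-- The filtration degree of a letter: the conformal weight of the field it belongs to. -/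
def letterDeg (a : Letter) : ℕ := bif a.1 then 3 else 2

/-- The filtration degree of a word. -/
def wordDeg (l : List Letter) : ℕ := (l.map letterDeg).sum

/-- The span of the words of weight `n` and of filtration degree less than `d`. -/
def wordSpan (d : ℕ) (n : ℤ) : Submodule ℂ M.carrier :=
  Submodule.span ℂ {v | ∃ l, wordDeg l < d ∧ wordWt l = n ∧ M.act l = v}

/-- The letters whose modes do not kill the vacuum. -/
def Creative (a : Letter) : Prop := bif a.1 then a.2 ≤ -3 else a.2 ≤ -2

@[simp] lemma op_false (n : ℤ) : M.op (false, n) = M.L n := rfl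

@[simp] lemma op_true (n : ℤ) : M.op (true, n) = M.W n := rfl

@[simp] lemma act_nil : M.act [] = M.one := rfl

@[simp] lemma act_cons (a : Letter) (l : List Letter) : M.act (a :: l) = M.op a (M.act l) := rfl

@[simp] lemma wordWt_nil : wordWt [] = 0 := rfl

@[simp] lemma wordWt_cons (a : Letter) (l : List Letter) :
    wordWt (a :: l) = -a.2 + wordWt l := by simp [wordWt]

@[simp] lemma wordDeg_nil : wordDeg [] = 0 := rfl

@[simp] lemma wordDeg_cons (a : Letter) (l : List Letter) :
    wordDeg (a :: l) = letterDeg a + wordDeg l := by simp [wordDeg]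

@[simp] lemma letterDeg_false (n : ℤ) : letterDeg (false, n) = 2 := rfl

@[simp] lemma letterDeg_true (n : ℤ) : letterDeg (true, n) = 3 := rfl

lemma wordWt_perm {l l' : List Letter} (h : l.Perm l') : wordWt l = wordWt l' :=
  (h.map _).sum_eq

lemma wordDeg_perm {l l' : List Letter} (h : l.Perm l') : wordDeg l = wordDeg l' :=
  (h.map _).sum_eq

lemma act_mem_wordSpan {d : ℕ} {n : ℤ} (l : List Letter) (hd : wordDeg l < d)
    (hn : wordWt l = n) : M.act l ∈ M.wordSpan d n :=
  Submodule.subset_span ⟨l, hd, hn, rfl⟩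

lemma op_mem_wordSpan (a : Letter) {d : ℕ} {n : ℤ} {v : M.carrier} (hv : v ∈ M.wordSpan d n) :
    M.op a v ∈ M.wordSpan (letterDeg a + d) (-a.2 + n) := by
  suffices M.wordSpan d n ≤ (M.wordSpan (letterDeg a + d) (-a.2 + n)).comap (M.op a) from this hv
  refine Submodule.span_le.2 ?_
  rintro _ ⟨l, hd, hn, rfl⟩
  exact M.act_mem_wordSpan (a :: l) (by simpa using hd) (by simp [hn])

lemma LL_swap_mem (m n : ℤ) (l : List Letter) :
    M.L m (M.L n (M.act l)) - M.L n (M.L m (M.act l))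
      ∈ M.wordSpan (2 + (2 + wordDeg l)) (-m + (-n + wordWt l)) := by
  rw [M.relLL]
  refine add_mem (Submodule.smul_mem _ _ ?_) ?_
  · exact M.act_mem_wordSpan ((false, m + n) :: l) (by simp) (by simp; ring)
  · split_ifs with h
    · exact Submodule.smul_mem _ _ (M.act_mem_wordSpan l (by omega) (by omega))
    · simp

lemma LW_swap_mem (m n : ℤ) (l : List Letter) :
    M.L m (M.W n (M.act l)) - M.W n (M.L m (M.act l))
      ∈ M.wordSpan (2 + (3 + wordDeg l)) (-m + (-n + wordWt l)) := by
  rw [M.relLW]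
  refine Submodule.smul_mem _ _ ?_
  exact M.act_mem_wordSpan ((true, m + n) :: l) (by simp) (by simp; ring)

lemma WW_swap_mem (m n : ℤ) (l : List Letter) :
    M.W m (M.W n (M.act l)) - M.W n (M.W m (M.act l))
      ∈ M.wordSpan (3 + (3 + wordDeg l)) (-m + (-n + wordWt l)) := by
  obtain ⟨N, hN⟩ := M.relWW m n (M.act l)
  rw [hN N le_rfl]
  have hL : M.L (m + n) (M.act l) ∈ M.wordSpan (3 + (3 + wordDeg l)) (-m + (-n + wordWt l)) :=
    M.act_mem_wordSpan ((false, m + n) :: l) (by simp; omega) (by simp; ring)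
  have hLL (i j : ℤ) (hij : i + j = m + n) : M.L i (M.L j (M.act l))
      ∈ M.wordSpan (3 + (3 + wordDeg l)) (-m + (-n + wordWt l)) :=
    M.act_mem_wordSpan ((false, i) :: (false, j) :: l) (by simp; omega) (by simp; omega)
  refine add_mem (add_mem (Submodule.smul_mem _ _ hL) (Submodule.smul_mem _ _
    (sub_mem (add_mem (sum_mem fun j _ => ?_) (sum_mem fun j _ => ?_))
      (Submodule.smul_mem _ _ hL)))) ?_
  · exact hLL _ _ (by ring)
  · exact hLL _ _ (by ring)
  · split_ifs with h
    · exact Submodule.smul_mem _ _ (M.act_mem_wordSpan l (by omega) (by omega))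
    · simp

lemma op_swap_mem (a b : Letter) (l : List Letter) :
    M.op a (M.op b (M.act l)) - M.op b (M.op a (M.act l))
      ∈ M.wordSpan (letterDeg a + (letterDeg b + wordDeg l)) (-a.2 + (-b.2 + wordWt l)) := by
  obtain ⟨_ | _, m⟩ := a <;> obtain ⟨_ | _, n⟩ := b
  · exact M.LL_swap_mem m n l
  · exact M.LW_swap_mem m n l
  · have h := M.LW_swap_mem n m l
    rw [← neg_mem_iff, neg_sub, add_left_comm, add_left_comm (-n)] at h
    exact h
  · exact M.WW_swap_mem m n l

/-- Permuting the letters of a word changes its vector by words of smaller degree. -/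
lemma act_sub_act_mem {l l' : List Letter} (h : l.Perm l') :
    M.act l - M.act l' ∈ M.wordSpan (wordDeg l) (wordWt l) := by
  induction h with
  | nil => simp
  | cons a h ih =>
    rw [act_cons, act_cons, ← map_sub, wordDeg_cons, wordWt_cons]
    exact M.op_mem_wordSpan a ih
  | swap a b l =>
    simpa using M.op_swap_mem b a l
  | trans h₁ h₂ ih₁ ih₂ =>
    rw [← wordDeg_perm h₁, ← wordWt_perm h₁] at ih₂
    simpa using add_mem ih₁ ih₂

lemma op_one_of_not_creative {a : Letter} (ha : ¬ Creative a) : M.op a M.one = 0 := by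
  obtain ⟨_ | _, n⟩ := a
  · exact M.L_one n (by simp [Creative] at ha; omega)
  · exact M.W_one n (by simp [Creative] at ha; omega)

lemma act_append (l l' : List Letter) (h : M.act l' = 0) : M.act (l ++ l') = 0 := by
  induction l with
  | nil => exact h
  | cons a l ih => simp [ih]

/-- A subspace that contains some rearrangement of each word of creation modes of weight `n`
contains all words of weight `n`. -/
lemma wordSpan_le {n : ℤ} {S : Submodule ℂ M.carrier}
    (hS : ∀ l, (∀ a ∈ l, Creative a) → wordWt l = n → ∃ l', l.Perm l' ∧ M.act l' ∈ S) (d : ℕ) :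
    M.wordSpan d n ≤ S := by
  induction d using Nat.strong_induction_on with
  | _ d ih =>
  refine Submodule.span_le.2 ?_
  rintro _ ⟨l, hd, rfl, rfl⟩
  suffices ∃ l', l.Perm l' ∧ M.act l' ∈ S by
    obtain ⟨l', hp, hl'⟩ := this
    simpa using add_mem (ih _ hd (M.act_sub_act_mem hp)) hl'
  by_cases hl : ∀ a ∈ l, Creative a
  · exact hS l hl rfl
  · push Not at hl
    obtain ⟨a, hal, ha⟩ := hl
    obtain ⟨s, t, rfl⟩ := List.append_of_mem hal
    refine ⟨(s ++ t) ++ [a], ?_, ?_⟩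
    · rw [List.append_assoc]
      exact (List.perm_append_comm (l₁ := [a])).append_left s
    · rw [M.act_append _ [a] (M.op_one_of_not_creative ha)]
      exact zero_mem S

lemma mem_wt_iff {r : ℂ} {v : M.carrier} : v ∈ M.wt r ↔ M.L 0 v = r • v := by
  simp [wt, sub_eq_zero]

lemma wt_eq_eigenspace (r : ℂ) : M.wt r = Module.End.eigenspace (M.L 0) r := by
  ext v
  rw [mem_wt_iff, Module.End.mem_eigenspace_iff]

lemma op_mem_wt (a : Letter) {n : ℤ} {v : M.carrier} (hv : v ∈ M.wt (n : ℂ)) :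
    M.op a v ∈ M.wt ((-a.2 + n : ℤ) : ℂ) := by
  rw [mem_wt_iff] at hv ⊢
  obtain ⟨_ | _, k⟩ := a
  · have h := M.relLL 0 k v
    rw [hv, map_smul] at h
    have h0 : (if 0 + k = 0 then (((0 : ℤ) ^ 3 - 0 : ℤ) : ℂ) / 12 * c else 0) = 0 := by simp
    rw [h0, zero_smul, add_zero, zero_add, sub_eq_iff_eq_add] at h
    simp only [op_false]
    rw [h]
    push_cast
    module
  · have h := M.relLW 0 k v
    rw [hv, map_smul, zero_add, sub_eq_iff_eq_add] at h
    simp only [op_true]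
    rw [h]
    push_cast
    module

lemma act_mem_wt (l : List Letter) : M.act l ∈ M.wt ((wordWt l : ℤ) : ℂ) := by
  induction l with
  | nil => simp [mem_wt_iff, M.L_one]
  | cons a l ih => simpa using M.op_mem_wt a ih

/-- The restriction of a representation to an invariant subspace containing the vacuum. -/
def restrict (N : Submodule ℂ M.carrier) (hN : M.Invariant N) (h1 : M.one ∈ N) : W3Rep c where
  carrier := N
  L n := (M.L n).restrict fun x hx => (hN n x hx).1
  W n := (M.W n).restrict fun x hx => (hN n x hx).2
  one := ⟨M.one, h1⟩
  L_one n hn := Subtype.ext (M.L_one n hn)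
  W_one n hn := Subtype.ext (M.W_one n hn)
  truncation v := by
    obtain ⟨N, hN⟩ := M.truncation v
    exact ⟨N, fun n hn => ⟨Subtype.ext (hN n hn).1, Subtype.ext (hN n hn).2⟩⟩
  relLL m n v := Subtype.ext (M.relLL m n v)
  relLW m n v := Subtype.ext (M.relLW m n v)
  relWW m n v := by
    obtain ⟨K₀, h⟩ := M.relWW m n v
    refine ⟨K₀, fun K hK => Subtype.ext ?_⟩
    simpa [-ite_smul] using h K hK

/-- The inclusion of the restriction of a representation to an invariant subspace. -/
def restrictIncl (N : Submodule ℂ M.carrier) (hN : M.Invariant N) (h1 : M.one ∈ N) :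
    W3Hom (M.restrict N hN h1) M where
  f := N.subtype
  map_one := rfl
  map_L _ _ := rfl
  map_W _ _ := rfl

/-- Normally ordered words of weight `3`. -/
def words₃ : Fin 2 → List Letter := ![[(false, -3)], [(true, -3)]]

/-- Normally ordered words of weight `4`. -/
def words₄ : Fin 3 → List Letter := ![[(false, -4)], [(false, -2), (false, -2)], [(true, -4)]]

/-- Normally ordered words of weight `5`. -/
def words₅ : Fin 4 → List Letter :=
  ![[(false, -5)], [(false, -3), (false, -2)], [(true, -5)], [(false, -2), (true, -3)]]

/-- Normally ordered words of weight `7`. -/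
def words₇ : Fin 10 → List Letter :=
  ![[(false, -7)], [(false, -5), (false, -2)], [(false, -4), (false, -3)],
    [(false, -3), (false, -2), (false, -2)], [(true, -7)], [(false, -2), (true, -5)],
    [(false, -3), (true, -4)], [(false, -4), (true, -3)], [(false, -2), (false, -2), (true, -3)],
    [(true, -4), (true, -3)]]

lemma two_mul_length_le_wordWt {l : List Letter} (hl : ∀ a ∈ l, Creative a) :
    2 * (l.length : ℤ) ≤ wordWt l := by
  induction l with
  | nil => simp
  | cons a l ih =>
    obtain ⟨ha, hl⟩ := List.forall_mem_cons.1 hl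
    have ih := ih hl
    obtain ⟨_ | _, k⟩ := a <;> simp [Creative] at ha ⊢ <;> linarith

lemma exists_perm_words₃ (l : List Letter) (hl : ∀ a ∈ l, Creative a) (hr : wordWt l = 3) :
    ∃ i, l.Perm (words₃ i) := by
  have hlen := two_mul_length_le_wordWt hl
  match l with
  | [] => simp at hr
  | [(b, k)] =>
    simp at hr
    obtain rfl : k = -3 := by omega
    cases b <;> decide
  | _ :: _ :: t => simp at hlen hr; omega

lemma exists_perm_words₄ (l : List Letter) (hl : ∀ a ∈ l, Creative a) (hr : wordWt l = 4) :
    ∃ i, l.Perm (words₄ i) := by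
  have hlen := two_mul_length_le_wordWt hl
  match l with
  | [] => simp at hr
  | [(b, k)] =>
    simp at hr
    obtain rfl : k = -4 := by omega
    cases b <;> decide
  | [(b, k), (b', k')] =>
    cases b <;> cases b' <;> simp [Creative] at hr hl
    · obtain ⟨rfl, rfl⟩ : k = -2 ∧ k' = -2 := by omega
      decide
    all_goals omega
  | _ :: _ :: _ :: t => simp at hlen hr; omega

lemma exists_perm_words₅ (l : List Letter) (hl : ∀ a ∈ l, Creative a) (hr : wordWt l = 5) :
    ∃ i, l.Perm (words₅ i) := by
  have hlen := two_mul_length_le_wordWt hl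
  match l with
  | [] => simp at hr
  | [(b, k)] =>
    simp at hr
    obtain rfl : k = -5 := by omega
    cases b <;> decide
  | [(b, k), (b', k')] =>
    obtain rfl : k' = -5 - k := by simp at hr; omega
    have hk : -3 ≤ k ∧ k ≤ -2 := by
      cases b <;> cases b' <;> simp [Creative] at hl <;> omega
    obtain ⟨h₁, h₂⟩ := hk
    cases b <;> cases b' <;> simp [Creative] at hl <;> interval_cases k <;> first | omega | decide
  | _ :: _ :: _ :: t => simp at hlen hr; omega

lemma exists_perm_words₇ (l : List Letter) (hl : ∀ a ∈ l, Creative a) (hr : wordWt l = 7) :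
    ∃ i, l.Perm (words₇ i) := by
  have hlen := two_mul_length_le_wordWt hl
  match l with
  | [] => simp at hr
  | [(b, k)] =>
    simp at hr
    obtain rfl : k = -7 := by omega
    cases b <;> decide
  | [(b, k), (b', k')] =>
    obtain rfl : k' = -7 - k := by simp at hr; omega
    have hk : -5 ≤ k ∧ k ≤ -2 := by
      cases b <;> cases b' <;> simp [Creative] at hl <;> omega
    obtain ⟨h₁, h₂⟩ := hk
    cases b <;> cases b' <;> simp [Creative] at hl <;> interval_cases k <;> first | omega | decide
  | [(b, k), (b', k'), (b'', k'')] =>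
    obtain rfl : k'' = -7 - k - k' := by simp at hr; omega
    have hk : (-3 ≤ k ∧ k ≤ -2) ∧ -3 ≤ k' ∧ k' ≤ -2 := by
      cases b <;> cases b' <;> cases b'' <;> simp [Creative] at hl <;> omega
    obtain ⟨⟨h₁, h₂⟩, h₃, h₄⟩ := hk
    cases b <;> cases b' <;> cases b'' <;> simp [Creative] at hl <;> interval_cases k <;>
      interval_cases k' <;> first | omega | decide
  | _ :: _ :: _ :: _ :: t => simp at hlen hr; omega

end W3Rep

namespace W3Vacuum

open W3Rep

variable {c : ℂ} (M : W3Vacuum c)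

lemma eq_top_of_invariant (N : Submodule ℂ M.carrier) (hN : M.Invariant N) (h1 : M.one ∈ N) :
    N = ⊤ := by
  obtain ⟨φ, -⟩ := M.universal (M.restrict N hN h1)
  obtain ⟨χ, hχ⟩ := M.universal M.toW3Rep
  let ι := M.restrictIncl N hN h1
  let i : W3Hom M.toW3Rep M.toW3Rep :=
    { f := ι.f ∘ₗ φ.f
      map_one := by rw [LinearMap.comp_apply, φ.map_one, ι.map_one]
      map_L := fun n v => by simp only [LinearMap.comp_apply, φ.map_L, ι.map_L]
      map_W := fun n v => by simp only [LinearMap.comp_apply, φ.map_W, ι.map_W] }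
  let j : W3Hom M.toW3Rep M.toW3Rep := ⟨LinearMap.id, rfl, fun _ _ => rfl, fun _ _ => rfl⟩
  have hij : i.f = j.f := by rw [hχ i, hχ j]
  refine eq_top_iff.2 fun v _ => ?_
  have hv : i.f v = v := by rw [hij]; rfl
  rw [← hv]
  exact (φ.f v).2

lemma span_act : Submodule.span ℂ (Set.range M.act) = ⊤ := by
  refine M.eq_top_of_invariant _ (fun n x hx => ?_) (Submodule.subset_span ⟨[], rfl⟩)
  have key (a : Letter) : Submodule.span ℂ (Set.range M.act)
      ≤ (Submodule.span ℂ (Set.range M.act)).comap (M.op a) := by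
    refine Submodule.span_le.2 ?_
    rintro _ ⟨l, rfl⟩
    exact Submodule.subset_span ⟨a :: l, rfl⟩
  exact ⟨key (false, n) hx, key (true, n) hx⟩

/-- A subspace that contains some rearrangement of each word of creation modes of weight `r`
contains the weight-`r` subspace. -/
lemma wt_le {r : ℤ} {S : Submodule ℂ M.carrier}
    (hS : ∀ l, (∀ a ∈ l, Creative a) → wordWt l = r → ∃ l', l.Perm l' ∧ M.act l' ∈ S) :
    M.wt (r : ℂ) ≤ S := by
  intro v hv
  have hdec : (⊤ : Submodule ℂ M.carrier)
      ≤ (M.wt (r : ℂ) ⊓ S) ⊔ ⨆ s : ℂ, ⨆ _ : s ≠ r, M.wt s := by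
    rw [← M.span_act]
    refine Submodule.span_le.2 ?_
    rintro _ ⟨l, rfl⟩
    by_cases h : wordWt l = r
    · refine Submodule.mem_sup_left ⟨h ▸ M.act_mem_wt l, ?_⟩
      exact M.wordSpan_le hS _ (M.act_mem_wordSpan l (Nat.lt_succ_self _) h)
    · refine Submodule.mem_sup_right (Submodule.mem_iSup_of_mem ((wordWt l : ℤ) : ℂ) ?_)
      exact Submodule.mem_iSup_of_mem (by exact_mod_cast h) (M.act_mem_wt l)
  obtain ⟨x, hx, y, hy, rfl⟩ := Submodule.mem_sup.1 (hdec (Submodule.mem_top (x := v)))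
  have hy' : y ∈ M.wt (r : ℂ) := by simpa using sub_mem hv hx.1
  have hdisj := Module.End.eigenspaces_iSupIndep (M.L 0) (r : ℂ)
  simp only [← M.wt_eq_eigenspace] at hdisj
  rw [Submodule.disjoint_def.1 hdisj y hy' hy, add_zero]
  exact hx.2

end W3Vacuum

namespace W3Rep

section Relations

variable {c : ℂ} (M : W3Rep c)

lemma L_L_of_lt {m n : ℤ} (_ : n < m) (v : M.carrier) :
    M.L m (M.L n v) = M.L n (M.L m v) + (((m - n : ℤ) : ℂ) • M.L (m + n) v
      + (if m + n = 0 then ((m ^ 3 - m : ℤ) : ℂ) / 12 * c else 0) • v) := by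
  rw [← M.relLL, add_sub_cancel]

lemma L_W_of_le {m : ℤ} (_ : -1 ≤ m) (n : ℤ) (v : M.carrier) :
    M.L m (M.W n v) = M.W n (M.L m v) + ((2 * m - n : ℤ) : ℂ) • M.W (m + n) v := by
  rw [← M.relLW, add_sub_cancel]

lemma W_L_of_le (m : ℤ) {n : ℤ} (_ : n ≤ -2) (v : M.carrier) :
    M.W m (M.L n v) = M.L n (M.W m v) - ((2 * n - m : ℤ) : ℂ) • M.W (m + n) v := by
  rw [add_comm m n, ← M.relLW, sub_sub_cancel]

/-- The commutator of two `W` modes on the vacuum, with the sum truncated where its terms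
start to vanish. -/
lemma W_W_one (m n : ℤ) (J : ℕ) (hJ : -3 ≤ m + n + J) :
    M.W m (M.W n M.one) = M.W n (M.W m M.one)
        + ((((m - n : ℤ) : ℂ) *
            ((1 / 15 : ℂ) * (((m + n + 2) * (m + n + 3) : ℤ) : ℂ)
              - (1 / 6 : ℂ) * (((m + 2) * (n + 2) : ℤ) : ℂ))) • M.L (m + n) M.one
        + ((16 / (22 + 5 * c)) * ((m - n : ℤ) : ℂ)) •
            ((∑ j ∈ Finset.range J, M.L (-((j : ℤ) + 2)) (M.L (m + n + ((j : ℤ) + 2)) M.one))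
              - ((3 / 10 : ℂ) * (((m + n + 2) * (m + n + 3) : ℤ) : ℂ)) • M.L (m + n) M.one)
        + (if m + n = 0 then ((m * (m ^ 2 - 1) * (m ^ 2 - 4) : ℤ) : ℂ) / 360 * c else 0)
            • M.one) := by
  obtain ⟨N, hN⟩ := M.relWW m n M.one
  have h := hN (max N J) (le_max_left _ _)
  have hsub : Finset.range J ⊆ Finset.range (max N J) :=
    Finset.range_subset_range.2 (le_max_right _ _)
  have hsecond : ∑ j ∈ Finset.range (max N J),
      M.L (m + n - ((j : ℤ) - 1)) (M.L ((j : ℤ) - 1) M.one) = 0 :=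
    Finset.sum_eq_zero fun j _ => by rw [M.L_one _ (by omega), map_zero]
  rw [hsecond, add_zero, ← Finset.sum_subset hsub fun j _ hj => ?_] at h
  · rw [← h, add_sub_cancel]
  · rw [M.L_one _ (by simp at hj; omega), map_zero]

end Relations

variable (M : W3Rep 1)

lemma W_three_W_one : M.W 3 (M.W (-3) M.one) = (1 / 3 : ℂ) • M.one := by
  rw [M.W_W_one 3 (-3) 0 (by norm_num)]
  norm_num [M.W_one, M.L_one]

lemma W_neg_one_W_one : M.W (-1) (M.W (-3) M.one)
    = (32 / 27 : ℂ) • M.L (-2) (M.L (-2) M.one) - (1 / 9 : ℂ) • M.L (-4) M.one := by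
  rw [M.W_W_one (-1) (-3) 1 (by norm_num)]
  norm_num [M.W_one, M.L_one, Finset.sum_range_succ]
  module

lemma W_neg_two_W_one : M.W (-2) (M.W (-3) M.one)
    = (32 / 27 : ℂ) • M.L (-3) (M.L (-2) M.one) - (2 / 27 : ℂ) • M.L (-5) M.one := by
  rw [M.W_W_one (-2) (-3) 2 (by norm_num)]
  norm_num [M.W_one, M.L_one, Finset.sum_range_succ, M.L_L_of_lt]
  module

lemma W_neg_three_W_one : M.W (-3) (M.W (-4) M.one)
    = M.W (-4) (M.W (-3) M.one) + (32 / 27 : ℂ) • M.L (-5) (M.L (-2) M.one)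
      + (32 / 27 : ℂ) • M.L (-4) (M.L (-3) M.one) - (5 / 27 : ℂ) • M.L (-7) M.one := by
  rw [M.W_W_one (-3) (-4) 4 (by norm_num)]
  norm_num [M.W_one, M.L_one, Finset.sum_range_succ, M.L_L_of_lt]
  module

lemma coeff_eq_zero_wt₃ (h1 : M.one ≠ 0) {a b : ℂ}
    (h : a • M.L (-3) M.one + b • M.W (-3) M.one = 0) :
    a = 0 ∧ b = 0 := by
  have hL := congrArg (M.L 3) h
  have hW := congrArg (M.W 3) h
  norm_num [M.L_one, M.W_one, M.L_L_of_lt, M.L_W_of_le, M.W_L_of_le, M.W_three_W_one, h1,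
    smul_smul] at hL hW
  exact ⟨hL, hW⟩

lemma coeff_eq_zero_wt₄ (h1 : M.one ≠ 0) {a b d : ℂ} {v : M.carrier}
    (hv : v = a • M.L (-4) M.one + b • M.L (-2) (M.L (-2) M.one) + d • M.W (-4) M.one)
    (hv₁ : M.L 1 v = 0) (hv₂ : M.L 2 v = 0) : a = 0 ∧ b = 0 ∧ d = 0 := by
  have e₁ : M.L 1 v = (5 * a + 3 * b) • M.L (-3) M.one + (6 * d) • M.W (-3) M.one := by
    rw [hv]
    norm_num [M.L_one, M.W_one, M.L_L_of_lt, M.L_W_of_le]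
    module
  have e₂ : M.L 2 (M.L 2 v) = (3 * a + 9 / 2 * b) • M.one := by
    rw [hv]
    norm_num [M.L_one, M.W_one, M.L_L_of_lt, M.L_W_of_le]
    module
  obtain ⟨h₁, h₂⟩ := M.coeff_eq_zero_wt₃ h1 (e₁.symm.trans hv₁)
  rw [hv₂, map_zero, eq_comm, smul_eq_zero_iff_left h1] at e₂
  grind

lemma coeff_eq_zero_wt₅ (h1 : M.one ≠ 0) {a b d e : ℂ} {v : M.carrier}
    (hv : v = a • M.L (-5) M.one + b • M.L (-3) (M.L (-2) M.one) + d • M.W (-5) M.one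
      + e • M.L (-2) (M.W (-3) M.one))
    (hv₁ : M.L 1 v = 0) (hv₂ : M.L 2 v = 0) : a = 0 ∧ b = 0 ∧ d = 0 ∧ e = 0 := by
  have e₂ : M.L 2 v = (7 * a + 11 / 2 * b) • M.L (-3) M.one
      + (9 * d + 25 / 2 * e) • M.W (-3) M.one := by
    rw [hv]
    norm_num [M.L_one, M.W_one, M.L_L_of_lt, M.L_W_of_le]
    module
  have e₁ : M.L 1 (M.L 1 v) = (30 * a + 12 * b) • M.L (-3) M.one
      + (42 * d + 18 * e) • M.W (-3) M.one := by
    rw [hv]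
    norm_num [M.L_one, M.W_one, M.L_L_of_lt, M.L_W_of_le]
    module
  rw [hv₁, map_zero] at e₁
  have h₁ := M.coeff_eq_zero_wt₃ h1 e₁.symm
  have h₂ := M.coeff_eq_zero_wt₃ h1 (e₂.symm.trans hv₂)
  grind

lemma coeff_eq_zero_wt₇ (h1 : M.one ≠ 0) {x y z t p q r s u a : ℂ} {v : M.carrier}
    (hv : v = x • M.L (-7) M.one + y • M.L (-5) (M.L (-2) M.one) + z • M.L (-4) (M.L (-3) M.one)
      + t • M.L (-3) (M.L (-2) (M.L (-2) M.one)) + p • M.W (-7) M.one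
      + q • M.L (-2) (M.W (-5) M.one) + r • M.L (-3) (M.W (-4) M.one)
      + s • M.L (-4) (M.W (-3) M.one) + u • M.L (-2) (M.L (-2) (M.W (-3) M.one))
      + a • M.W (-4) (M.W (-3) M.one))
    (hv₁ : M.L 1 v = 0) (hv₂ : M.L 2 v = 0) (hv₃ : M.L 3 v = 0) : v = 0 := by
  have e₁ : M.L 1 (M.L 1 v) = (56 * x + 20 * z + 36 * t - 20 / 9 * a) • M.L (-5) M.one
      + (30 * y + 60 * z + 60 * t + 320 / 9 * a) • M.L (-3) (M.L (-2) M.one)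
      + (72 * p + 114 * q + 24 * r + 36 * u) • M.W (-5) M.one
      + (42 * q + 48 * r + 20 * s + 48 * u) • M.L (-2) (M.W (-3) M.one) := by
    rw [hv]
    norm_num [M.L_one, M.W_one, M.L_L_of_lt, M.L_W_of_le, M.W_L_of_le, M.W_neg_two_W_one]
    module
  have e₂ : M.L 2 v = (9 * x + 1 / 2 * y + 6 * z + 5 * t - 16 / 27 * a) • M.L (-5) M.one
      + (7 * y + 6 * z + 19 * t + 256 / 27 * a) • M.L (-3) (M.L (-2) M.one)
      + (11 * p + 41 / 2 * q + 10 * r) • M.W (-5) M.one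
      + (9 * q + 6 * s + 33 * u) • M.L (-2) (M.W (-3) M.one) := by
    rw [hv]
    norm_num [M.L_one, M.W_one, M.L_L_of_lt, M.L_W_of_le, M.W_L_of_le, M.W_neg_two_W_one]
    module
  have e₃ : M.L 3 v = (10 * x + 16 * z - 10 / 9 * a) • M.L (-4) M.one
      + (8 * y + 26 * t + 320 / 27 * a) • M.L (-2) (M.L (-2) M.one)
      + (13 * p + 35 * q + 26 * r + 7 * s + 15 * u) • M.W (-4) M.one := by
    rw [hv]
    norm_num [M.L_one, M.W_one, M.L_L_of_lt, M.L_W_of_le, M.W_L_of_le, M.W_neg_one_W_one]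
    module
  have h₁ := M.coeff_eq_zero_wt₅ h1 e₁ (by simp [hv₁]) (by simp [hv₁])
  have h₂ := M.coeff_eq_zero_wt₅ h1 e₂ (by simp [hv₂]) (by simp [hv₂])
  have h₃ := M.coeff_eq_zero_wt₄ h1 e₃ (by simp [hv₃]) (by simp [hv₃])
  obtain ⟨rfl, rfl, rfl, rfl⟩ : p = 0 ∧ q = 0 ∧ r = 0 ∧ s = 0 := by grind
  obtain ⟨rfl, rfl, rfl, rfl, rfl⟩ : u = 0 ∧ x = 161 / 225 * a ∧ y = 94 / 75 * a
      ∧ z = -17 / 45 * a ∧ t = -568 / 675 * a := by grind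
  have e₀ : M.L (-1) (M.L 1 v) = (12 : ℂ) • v := by
    rw [hv]
    norm_num [M.L_one, M.W_one, M.L_L_of_lt, M.L_W_of_le, M.W_L_of_le, M.W_neg_three_W_one]
    module
  rw [hv₁, map_zero, eq_comm] at e₀
  exact (smul_eq_zero_iff_right (by norm_num)).1 e₀

end W3Rep

namespace W3Vacuum

open W3Rep

lemma wt_eq_span {c : ℂ} (M : W3Vacuum c) {r : ℤ} {k : ℕ} (words : Fin k → List Letter)
    (hwt : ∀ i, wordWt (words i) = r)
    (hwords : ∀ l, (∀ a ∈ l, Creative a) → wordWt l = r → ∃ i, l.Perm (words i)) :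
    M.wt (r : ℂ) = Submodule.span ℂ (Set.range fun i => M.act (words i)) := by
  refine le_antisymm (M.wt_le fun l hl hr => ?_) (Submodule.span_le.2 ?_)
  · obtain ⟨i, hi⟩ := hwords l hl hr
    exact ⟨_, hi, Submodule.subset_span ⟨i, rfl⟩⟩
  · rintro _ ⟨i, rfl⟩
    rw [← hwt i]
    exact M.act_mem_wt _

lemma finrank_wt {c : ℂ} (M : W3Vacuum c) {r : ℤ} {k : ℕ} (words : Fin k → List Letter)
    (hwt : ∀ i, wordWt (words i) = r)
    (hwords : ∀ l, (∀ a ∈ l, Creative a) → wordWt l = r → ∃ i, l.Perm (words i))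
    (hind : ∀ g : Fin k → ℂ, ∑ i, g i • M.act (words i) = 0 → ∀ i, g i = 0) :
    Module.finrank ℂ ↥(M.wt (r : ℂ)) = k := by
  rw [M.wt_eq_span words hwt hwords,
    finrank_span_eq_card (Fintype.linearIndependent_iff.2 hind), Fintype.card_fin]

lemma exists_eq_sum {c : ℂ} (M : W3Vacuum c) {r : ℤ} {k : ℕ} (words : Fin k → List Letter)
    (hwt : ∀ i, wordWt (words i) = r)
    (hwords : ∀ l, (∀ a ∈ l, Creative a) → wordWt l = r → ∃ i, l.Perm (words i))
    {v : M.carrier} (hv : v ∈ M.wt (r : ℂ)) :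
    ∃ g : Fin k → ℂ, v = ∑ i, g i • M.act (words i) := by
  rw [M.wt_eq_span words hwt hwords, Submodule.mem_span_range_iff_exists_fun] at hv
  exact hv.imp fun _ h => h.symm

variable (M : W3Vacuum 1)

lemma finrank_wt₃ : Module.finrank ℂ ↥(M.wt 3) = 2 := by
  rw [← Int.cast_ofNat]
  refine M.finrank_wt words₃ (by decide) exists_perm_words₃ fun g hg => ?_
  simpa [Fin.forall_fin_succ] using M.coeff_eq_zero_wt₃ M.one_ne
    (a := g 0) (b := g 1) (by simpa [Fin.sum_univ_succ, words₃] using hg)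

lemma finrank_wt₄ : Module.finrank ℂ ↥(M.wt 4) = 3 := by
  rw [← Int.cast_ofNat]
  refine M.finrank_wt words₄ (by decide) exists_perm_words₄ fun g hg => ?_
  simpa [Fin.forall_fin_succ] using M.coeff_eq_zero_wt₄ M.one_ne
    (a := g 0) (b := g 1) (d := g 2) (v := 0)
    (by simpa [Fin.sum_univ_succ, words₄, add_assoc] using hg.symm) (map_zero _) (map_zero _)

lemma finrank_wt₅ : Module.finrank ℂ ↥(M.wt 5) = 4 := by
  rw [← Int.cast_ofNat]
  refine M.finrank_wt words₅ (by decide) exists_perm_words₅ fun g hg => ?_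
  simpa [Fin.forall_fin_succ] using M.coeff_eq_zero_wt₅ M.one_ne
    (a := g 0) (b := g 1) (d := g 2) (e := g 3) (v := 0)
    (by simpa [Fin.sum_univ_succ, words₅, add_assoc] using hg.symm) (map_zero _) (map_zero _)

lemma eq_zero_of_wt₄ {v : M.carrier} (hv : v ∈ M.wt (4 : ℤ)) (hp : ∀ n : ℤ, 1 ≤ n → M.L n v = 0) :
    v = 0 := by
  obtain ⟨g, hg⟩ := M.exists_eq_sum words₄ (by decide) exists_perm_words₄ hv
  have hg' : v = g 0 • M.L (-4) M.one + g 1 • M.L (-2) (M.L (-2) M.one)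
      + g 2 • M.W (-4) M.one := by
    simpa [Fin.sum_univ_succ, words₄, add_assoc] using hg
  obtain ⟨h₀, h₁, h₂⟩ := M.coeff_eq_zero_wt₄ M.one_ne hg' (hp 1 (by decide)) (hp 2 (by decide))
  simpa [h₀, h₁, h₂] using hg'

lemma eq_zero_of_wt₅ {v : M.carrier} (hv : v ∈ M.wt (5 : ℤ)) (hp : ∀ n : ℤ, 1 ≤ n → M.L n v = 0) :
    v = 0 := by
  obtain ⟨g, hg⟩ := M.exists_eq_sum words₅ (by decide) exists_perm_words₅ hv
  have hg' : v = g 0 • M.L (-5) M.one + g 1 • M.L (-3) (M.L (-2) M.one) + g 2 • M.W (-5) M.one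
      + g 3 • M.L (-2) (M.W (-3) M.one) := by
    simpa [Fin.sum_univ_succ, words₅, add_assoc] using hg
  obtain ⟨h₀, h₁, h₂, h₃⟩ :=
    M.coeff_eq_zero_wt₅ M.one_ne hg' (hp 1 (by decide)) (hp 2 (by decide))
  simpa [h₀, h₁, h₂, h₃] using hg'

lemma eq_zero_of_wt₇ {v : M.carrier} (hv : v ∈ M.wt (7 : ℤ)) (hp : ∀ n : ℤ, 1 ≤ n → M.L n v = 0) :
    v = 0 := by
  obtain ⟨g, hg⟩ := M.exists_eq_sum words₇ (by decide) exists_perm_words₇ hv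
  refine M.coeff_eq_zero_wt₇ M.one_ne (v := v) (x := g 0) (y := g 1) (z := g 2) (t := g 3)
    (p := g 4) (q := g 5) (r := g 6) (s := g 7) (u := g 8) (a := g 9) ?_
    (hp 1 (by decide)) (hp 2 (by decide)) (hp 3 (by decide))
  rw [hg]
  simp only [Fin.sum_univ_succ, Fin.sum_univ_zero, add_zero, add_assoc]
  rfl

end W3Vacuum

/-- In `M̄(1,0,0)`, the weight-`r` subspace has dimension
`r - 1` for `3 ≤ r ≤ 5`, and there is no nonzero primary vector of weight
`4`, `5` or `7`. -/
theorem W3_vacuum_small_weights (M : W3Vacuum 1) :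
    (∀ r : ℕ, 3 ≤ r → r ≤ 5 →
      Module.finrank ℂ ↥(M.toW3Rep.wt (r : ℂ)) = r - 1) ∧
    (∀ r : ℕ, r = 4 ∨ r = 5 ∨ r = 7 →
      ∀ v ∈ M.toW3Rep.wt (r : ℂ), ¬ M.toW3Rep.IsPrimary v) := by
  refine ⟨fun r h₃ h₅ => ?_, fun r hr v hv hp => hp.1 ?_⟩
  · obtain rfl | rfl | rfl : r = 3 ∨ r = 4 ∨ r = 5 := by omega
    · simpa using M.finrank_wt₃
    · simpa using M.finrank_wt₄
    · simpa using M.finrank_wt₅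
  · rcases hr with rfl | rfl | rfl
    · exact M.eq_zero_of_wt₄ (by simpa using hv) hp.2
    · exact M.eq_zero_of_wt₅ (by simpa using hv) hp.2
    · exact M.eq_zero_of_wt₇ (by simpa using hv) hp.2
end
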